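/- Let n ≥ 2 be even. The function G : {z ∈ ℂⁿ : s(z) ≠ 0} → Cl_n(ℂ) defined by G(z) = s(z)^{−n/2}·ι(z) is holomorphic and is both complex left monogenic and complex right monogenic on its domain: Σ_{j=1}^n ι(e_j)·(∂G/∂z_j)(z) = 0 and Σ_{j=1}^n (∂G/∂z_j)(z)·ι(e_j) = 0 whenever s(z) ≠ 0. Moreover G(z) = (−1)^{n/2}·ι(z)^{−(n−1)} on this set, and for every nonzero x ∈ ℝⁿ (embedded in ℂⁿ) one has G(x) = ι(x)/‖x‖ⁿ; i.e. G is the holomorphic extension of the Euclidean Cauchy kernel to the complement of the null cone N(0). -/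

import Mathlib

noncomputable section
open MeasureTheory
open scoped BigOperators ENNReal

/-- ℂⁿ with its Euclidean norm. -/
abbrev Cn (n : ℕ) := EuclideanSpace ℂ (Fin n)
/-- ℝⁿ with its Euclidean norm. -/
abbrev Rn (n : ℕ) := EuclideanSpace ℝ (Fin n)

/-- `s z = z₁² + ⋯ + zₙ²`. -/
def sC (n : ℕ) (z : Cn n) : ℂ := ∑ j, z j ^ 2

/-- The quadratic form `Q z = -(z₁² + ⋯ + zₙ²)` on ℂⁿ. -/
def Qf (n : ℕ) : QuadraticForm ℂ (Cn n) :=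
  (QuadraticMap.weightedSumSquares ℂ (fun _ : Fin n => (-1 : ℂ))).comp
    (WithLp.linearEquiv 2 ℂ (Fin n → ℂ)).toLinearMap

/-- The complex Clifford algebra `Cl_n(ℂ)`. -/
abbrev Cl (n : ℕ) := CliffordAlgebra (Qf n)

/-- The structure map `ι : ℂⁿ → Cl_n(ℂ)`. -/
def ιC (n : ℕ) : Cn n →ₗ[ℂ] Cl n := CliffordAlgebra.ι (Qf n)

/-- The `j`-th standard basis vector of ℂⁿ. -/
def eC (n : ℕ) (j : Fin n) : Cn n := EuclideanSpace.single j 1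
/-- The `j`-th standard basis vector of ℝⁿ. -/
def eR (n : ℕ) (j : Fin n) : Rn n := EuclideanSpace.single j 1

/-- The componentwise embedding ℝⁿ → ℂⁿ. -/
def jmap (n : ℕ) (x : Rn n) : Cn n := (WithLp.equiv 2 (Fin n → ℂ)).symm fun i => (x i : ℂ)

/-- The complex Cauchy kernel `G(z) = s(z)^{-n/2} • ι(z)` (for `n` even). -/
def Gc (n : ℕ) (z : Cn n) : Cl n := ((sC n z) ^ (n / 2))⁻¹ • ιC n z

/-- The Euclidean Cauchy kernel `G(x) = ι(x)/‖x‖ⁿ`, `x ∈ ℝⁿ ∖ {0} ⊆ ℂⁿ`. -/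
def Gr (n : ℕ) (x : Rn n) : Cl n := (((‖x‖ ^ n : ℝ) : ℂ))⁻¹ • ιC n (jmap n x)

/-- `f : ℝⁿ → Cl_n(ℂ)` is differentiable on `U` with coordinate partial derivatives
`Df x j = (∂f/∂x_j)(x)`, tested against all `ℂ`-linear functionals of the
(finite-dimensional) Clifford algebra. -/
def HasPartialDerivsOn (n : ℕ) (f : Rn n → Cl n) (Df : Rn n → Fin n → Cl n)
    (U : Set (Rn n)) : Prop :=
  ∀ φ : Cl n →ₗ[ℂ] ℂ, ∀ x ∈ U, DifferentiableAt ℝ (fun y => φ (f y)) x ∧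
    ∀ j : Fin n, fderiv ℝ (fun y => φ (f y)) x (eR n j) = φ (Df x j)

/-- `f` is left monogenic on `U`: it is differentiable and `∑ⱼ ι(eⱼ) · ∂f/∂xⱼ = 0` on `U`. -/
def IsLeftMonogenicOn (n : ℕ) (f : Rn n → Cl n) (U : Set (Rn n)) : Prop :=
  ∃ Df : Rn n → Fin n → Cl n, HasPartialDerivsOn n f Df U ∧
    ∀ x ∈ U, ∑ j, ιC n (eC n j) * Df x j = 0

/-- `f` is right monogenic on `U`: it is differentiable and `∑ⱼ (∂f/∂xⱼ) · ι(eⱼ) = 0` on `U`. -/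
def IsRightMonogenicOn (n : ℕ) (f : Rn n → Cl n) (U : Set (Rn n)) : Prop :=
  ∃ Df : Rn n → Fin n → Cl n, HasPartialDerivsOn n f Df U ∧
    ∀ x ∈ U, ∑ j, Df x j * ιC n (eC n j) = 0

/-- `F : ℂⁿ → Cl_n(ℂ)` is holomorphic on `Ω` with complex coordinate partial
derivatives `DF z j = (∂F/∂z_j)(z)`, tested against all `ℂ`-linear functionals. -/
def HasCPartialDerivsOn (n : ℕ) (F : Cn n → Cl n) (DF : Cn n → Fin n → Cl n)
    (Ω : Set (Cn n)) : Prop :=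
  ∀ φ : Cl n →ₗ[ℂ] ℂ, ∀ z ∈ Ω, DifferentiableAt ℂ (fun w => φ (F w)) z ∧
    ∀ j : Fin n, fderiv ℂ (fun w => φ (F w)) z (eC n j) = φ (DF z j)

/-- `F : ℂⁿ → Cl_n(ℂ)` is holomorphic (ℂ-differentiable) on `Ω`. -/
def IsHolomorphicOn (n : ℕ) (F : Cn n → Cl n) (Ω : Set (Cn n)) : Prop :=
  ∀ φ : Cl n →ₗ[ℂ] ℂ, ∀ z ∈ Ω, DifferentiableAt ℂ (fun w => φ (F w)) z

/-- `F` is complex left monogenic on `Ω`: holomorphic with `∑ⱼ ι(eⱼ) · ∂F/∂zⱼ = 0` on `Ω`. -/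
def IsCLeftMonogenicOn (n : ℕ) (F : Cn n → Cl n) (Ω : Set (Cn n)) : Prop :=
  ∃ DF : Cn n → Fin n → Cl n, HasCPartialDerivsOn n F DF Ω ∧
    ∀ z ∈ Ω, ∑ j, ιC n (eC n j) * DF z j = 0

/-- `F` is complex right monogenic on `Ω`: holomorphic with `∑ⱼ (∂F/∂zⱼ) · ι(eⱼ) = 0` on `Ω`. -/
def IsCRightMonogenicOn (n : ℕ) (F : Cn n → Cl n) (Ω : Set (Cn n)) : Prop :=
  ∃ DF : Cn n → Fin n → Cl n, HasCPartialDerivsOn n F DF Ω ∧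
    ∀ z ∈ Ω, ∑ j, DF z j * ιC n (eC n j) = 0

theorem ιC_mul_self (n : ℕ) (z : Cn n) : ιC n z * ιC n z = -(sC n z) • (1 : Cl n) := by
  rw [ιC, CliffordAlgebra.ι_sq_scalar, Algebra.algebraMap_eq_smul_one]
  congr 1
  simp [Qf, sC, QuadraticMap.weightedSumSquares_apply, pow_two]

theorem sum_smul_eC (n : ℕ) (z : Cn n) : ∑ j, z j • eC n j = z := by
  ext i
  simp [eC, Finset.sum_apply, Pi.single_apply]

theorem sum_smul_ιC_eC (n : ℕ) (z : Cn n) : ∑ j, z j • ιC n (eC n j) = ιC n z := by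
  conv_rhs => rw [← sum_smul_eC n z]
  simp

theorem sC_eC (n : ℕ) (j : Fin n) : sC n (eC n j) = 1 := by
  simp [sC, eC]

theorem sum_ιC_eC_mul_self (n : ℕ) :
    ∑ j, ιC n (eC n j) * ιC n (eC n j) = -(n : ℂ) • (1 : Cl n) := by
  simp [ιC_mul_self, sC_eC, ← Nat.cast_smul_eq_nsmul ℂ]

theorem sum_ιC_eC_mul_smul (n : ℕ) (z : Cn n) :
    ∑ j, ιC n (eC n j) * z j • ιC n z = -(sC n z) • (1 : Cl n) := by
  simp_rw [← ιC_mul_self, mul_smul_comm, ← smul_mul_assoc]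
  rw [← Finset.sum_mul, sum_smul_ιC_eC]

theorem sum_smul_mul_ιC_eC (n : ℕ) (z : Cn n) :
    ∑ j, z j • ιC n z * ιC n (eC n j) = -(sC n z) • (1 : Cl n) := by
  simp_rw [← ιC_mul_self, smul_mul_assoc, ← mul_smul_comm]
  rw [← Finset.mul_sum, sum_smul_ιC_eC]

theorem hasFDerivAt_sC (n : ℕ) (z : Cn n) :
    HasFDerivAt (sC n) (∑ j, (2 * z j) • (EuclideanSpace.proj j : Cn n →L[ℂ] ℂ)) z := by
  have h (j : Fin n) : HasFDerivAt (fun w : Cn n => w j ^ 2)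
      ((2 * z j) • (EuclideanSpace.proj j : Cn n →L[ℂ] ℂ)) z := by
    simpa using (EuclideanSpace.proj j : Cn n →L[ℂ] ℂ).hasFDerivAt.pow 2 (x := z)
  exact HasFDerivAt.fun_sum fun j _ => h j

theorem hasDerivAt_pow_inv (m : ℕ) {t : ℂ} (ht : t ≠ 0) :
    HasDerivAt (fun u : ℂ => (u ^ m)⁻¹) (-m * (t ^ (m + 1))⁻¹) t := by
  refine ((hasDerivAt_pow m t).fun_inv (pow_ne_zero m ht)).congr_deriv ?_
  cases m with
  | zero => simp
  | succ k =>
    rw [Nat.add_sub_cancel]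
    field_simp
    ring

/-- The partial derivative `∂G/∂z_j` of the complex Cauchy kernel. -/
def GcPartial (n : ℕ) (z : Cn n) (j : Fin n) : Cl n :=
  ((sC n z) ^ (n / 2))⁻¹ • ιC n (eC n j) -
    (2 * (n / 2 : ℕ) * ((sC n z) ^ (n / 2 + 1))⁻¹) • (z j • ιC n z)

theorem hasCPartialDerivsOn_Gc (n : ℕ) :
    HasCPartialDerivsOn n (Gc n) (GcPartial n) {z : Cn n | sC n z ≠ 0} := by
  intro φ z hz
  have hφ : HasFDerivAt (fun w => φ (ιC n w)) (φ ∘ₗ ιC n).toContinuousLinearMap z :=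
    (φ ∘ₗ ιC n).toContinuousLinearMap.hasFDerivAt
  have hG := ((hasDerivAt_pow_inv (n / 2) hz).comp_hasFDerivAt z (hasFDerivAt_sC n z)).mul hφ
  rw [show (fun w => φ (Gc n w)) = fun w => ((sC n w) ^ (n / 2))⁻¹ * φ (ιC n w) by
    simp only [Gc, map_smul, smul_eq_mul]]
  refine ⟨hG.differentiableAt, fun j => ?_⟩
  refine (congrArg (· (eC n j)) hG.fderiv).trans ?_
  simp [GcPartial, eC]
  ring

theorem cast_two_mul_half {n : ℕ} (heven : Even n) : (2 * (n / 2 : ℕ) : ℂ) = n := by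
  exact_mod_cast Nat.two_mul_div_two_of_even heven

theorem sum_ιC_eC_mul_GcPartial {n : ℕ} (heven : Even n) {z : Cn n} (hz : sC n z ≠ 0) :
    ∑ j, ιC n (eC n j) * GcPartial n z j = 0 := by
  simp_rw [GcPartial, cast_two_mul_half heven, mul_sub, mul_smul_comm _ (ιC n (eC n _))]
  rw [Finset.sum_sub_distrib, ← Finset.smul_sum, ← Finset.smul_sum, sum_ιC_eC_mul_self]
  simp_rw [← mul_smul_comm]
  rw [sum_ιC_eC_mul_smul, smul_smul, smul_smul, ← sub_smul]
  convert zero_smul ℂ (1 : Cl n)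
  field_simp
  ring

theorem sum_GcPartial_mul_ιC_eC {n : ℕ} (heven : Even n) {z : Cn n} (hz : sC n z ≠ 0) :
    ∑ j, GcPartial n z j * ιC n (eC n j) = 0 := by
  simp_rw [GcPartial, cast_two_mul_half heven, sub_mul, smul_mul_assoc _ _ (ιC n (eC n _))]
  rw [Finset.sum_sub_distrib, ← Finset.smul_sum, ← Finset.smul_sum, sum_ιC_eC_mul_self]
  simp_rw [← smul_mul_assoc]
  rw [sum_smul_mul_ιC_eC, smul_smul, smul_smul, ← sub_smul]
  convert zero_smul ℂ (1 : Cl n)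
  field_simp
  ring

theorem inverse_ιC {n : ℕ} {z : Cn n} (hz : sC n z ≠ 0) :
    Ring.inverse (ιC n z) = (-sC n z)⁻¹ • ιC n z := by
  have h : (-sC n z)⁻¹ * -sC n z = 1 := inv_mul_cancel₀ (neg_ne_zero.mpr hz)
  exact Ring.inverse_unit ⟨ιC n z, (-sC n z)⁻¹ • ιC n z,
    by rw [mul_smul_comm, ιC_mul_self, smul_smul, h, one_smul],
    by rw [smul_mul_assoc, ιC_mul_self, smul_smul, h, one_smul]⟩

theorem Gc_eq_inverse_pow {n : ℕ} (hn : 2 ≤ n) (heven : Even n) {z : Cn n} (hz : sC n z ≠ 0) :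
    Gc n z = ((-1 : ℂ) ^ (n / 2)) • (Ring.inverse (ιC n z)) ^ (n - 1) := by
  obtain ⟨k, rfl⟩ : ∃ k, n = 2 * (k + 1) := by
    obtain ⟨m, rfl⟩ := heven
    exact ⟨m - 1, by omega⟩
  have hdiv : 2 * (k + 1) / 2 = k + 1 := by omega
  have hsub : 2 * (k + 1) - 1 = 2 * k + 1 := by omega
  rw [inverse_ιC hz, smul_pow, Gc, hdiv, hsub, pow_succ (ιC _ z), pow_mul (ιC _ z),
    pow_two (ιC _ z), ιC_mul_self, smul_pow, one_pow, smul_mul_assoc, one_mul, smul_smul, smul_smul]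
  congr 1
  have h1 : (-1 : ℂ) ^ (k * 2) = 1 := by simp [pow_mul']
  rw [neg_pow (sC _ z) k, inv_pow, neg_pow (sC _ z) (2 * k + 1), pow_succ (-1 : ℂ) (2 * k), pow_mul]
  field_simp
  ring_nf
  simp [h1]

theorem sC_jmap (n : ℕ) (x : Rn n) : sC n (jmap n x) = ((‖x‖ ^ 2 : ℝ) : ℂ) := by
  simp [EuclideanSpace.real_norm_sq_eq, sC, jmap]

theorem Gc_jmap {n : ℕ} (heven : Even n) (x : Rn n) : Gc n (jmap n x) = Gr n x := by
  rw [Gc, Gr, sC_jmap, ← Complex.ofReal_pow, ← pow_mul, Nat.two_mul_div_two_of_even heven]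

/-- For `n ≥ 2` even, the complex Cauchy kernel `G(z) = s(z)^{-n/2}·ι(z)`
is holomorphic and both complex left and right monogenic on `{z : s(z) ≠ 0}`; moreover
`G(z) = (-1)^{n/2}·ι(z)^{-(n-1)}` there, and on `ℝⁿ ∖ {0}` it restricts to the Euclidean
Cauchy kernel `x ↦ ι(x)/‖x‖ⁿ`. -/
theorem complex_cauchy_kernel_monogenic (n : ℕ) (hn : 2 ≤ n) (heven : Even n) :
    IsHolomorphicOn n (Gc n) {z : Cn n | sC n z ≠ 0} ∧
    IsCLeftMonogenicOn n (Gc n) {z : Cn n | sC n z ≠ 0} ∧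
    IsCRightMonogenicOn n (Gc n) {z : Cn n | sC n z ≠ 0} ∧
    (∀ z : Cn n, sC n z ≠ 0 →
      Gc n z = ((-1 : ℂ) ^ (n / 2)) • (Ring.inverse (ιC n z)) ^ (n - 1)) ∧
    (∀ x : Rn n, x ≠ 0 → Gc n (jmap n x) = Gr n x) := by
  have hG := hasCPartialDerivsOn_Gc n
  exact ⟨fun φ z hz => (hG φ z hz).1,
    ⟨GcPartial n, hG, fun _ hz => sum_ιC_eC_mul_GcPartial heven hz⟩,
    ⟨GcPartial n, hG, fun _ hz => sum_GcPartial_mul_ιC_eC heven hz⟩,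
    fun _ hz => Gc_eq_inverse_pow hn heven hz, fun x _ => Gc_jmap heven x⟩
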